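/- arXiv:2509.01029 — 2 statements merged into one kernel-verified Lean document; each statement's English description precedes it below -/
import Mathlib

section
/- Let ℱ be a construction scheme whose type satisfies n_{k+1} ≥ 2^{m_k} for all k, let n ≥ 1, and let e_α, o_α (α < ω₁) be defined as in the context. Then for all α ≠ β < ω₁: the least k with e_α(k) ≠ e_β(k), the least k with o_α(k) ≠ o_β(k), and the least k with Ξ_α(k) ≠ Ξ_β(k) all exist and are equal to Δ(α,β). Consequently the maps α ↦ e_α, α ↦ o_α and α ↦ Ξ_α are injective, and the bijections Ξ_α ↦ e_α and Ξ_α ↦ o_α are homeomorphisms between {Ξ_α : α < ω₁}, {e_α : α < ω₁} and {o_α : α < ω₁}, viewed as subspaces of ℤ^ω with the product topology (ℤ discrete). -/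
noncomputable section

open scoped Classical

/-- The first uncountable ordinal. -/
def omegaOne : Ordinal := (Cardinal.aleph 1).ord

/-- A scheme type. -/
structure SchemeType where
  m : ℕ → ℕ
  n : ℕ → ℕ
  r : ℕ → ℕ
  m_zero : m 0 = 1
  n_ge : ∀ k, 2 ≤ n (k + 1)
  r_lt : ∀ k, r (k + 1) < m k
  m_succ : ∀ k, m (k + 1) = r (k + 1) + (m k - r (k + 1)) * n (k + 1)

/-- `A` is an initial segment of `B`. -/
def InitSeg (A B : Finset Ordinal) : Prop := ∀ a ∈ A, ∀ b ∈ B, b < a → b ∈ A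

/-- `D`, `R` form the canonical decomposition of `F ∈ ℱ_{k+1}`. -/
def IsDecomposition (T : SchemeType) (ℱ : Set (Finset Ordinal)) (k : ℕ)
    (F : Finset Ordinal) (D : ℕ → Finset Ordinal) (R : Finset Ordinal) : Prop :=
  (∀ i < T.n (k + 1), D i ∈ ℱ ∧ (D i).card = T.m k) ∧
  F = (Finset.range (T.n (k + 1))).biUnion D ∧
  R.card = T.r (k + 1) ∧
  (∀ i < T.n (k + 1), ∀ j < T.n (k + 1), i ≠ j → D i ∩ D j = R) ∧
  (∀ i < T.n (k + 1), ∀ x ∈ R, ∀ y ∈ D i \ R, x < y) ∧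
  (∀ i j, i < j → j < T.n (k + 1) → ∀ x ∈ D i \ R, ∀ y ∈ D j \ R, x < y)

/-- `ℱ` is a construction scheme of type `T` on `ω₁`. -/
structure IsConstructionScheme (T : SchemeType) (ℱ : Set (Finset Ordinal)) : Prop where
  nonempty_mem : ∀ F ∈ ℱ, F.Nonempty
  mem_subset : ∀ F ∈ ℱ, ↑F ⊆ Set.Iio omegaOne
  cofinal : ∀ A : Finset Ordinal, ↑A ⊆ Set.Iio omegaOne → ∃ F ∈ ℱ, A ⊆ F
  card_eq : ∀ F ∈ ℱ, ∃ k, F.card = T.m k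
  inter_initSeg : ∀ k : ℕ, ∀ E ∈ ℱ, ∀ F ∈ ℱ, E.card = T.m k → F.card = T.m k →
    InitSeg (E ∩ F) E ∧ InitSeg (E ∩ F) F
  decomp : ∀ k : ℕ, ∀ F ∈ ℱ, F.card = T.m (k + 1) → ∃ D R, IsDecomposition T ℱ k F D R

/-- `ρ(α,β)`: least `k` such that `{α,β}` is included in a member of `ℱ_k`. -/
def rho (T : SchemeType) (ℱ : Set (Finset Ordinal)) (α β : Ordinal) : ℕ :=
  sInf {k | ∃ F ∈ ℱ, F.card = T.m k ∧ α ∈ F ∧ β ∈ F}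

/-- `‖α‖_k`, the cardinality of `(α)_k \ {α}`. -/
def nrm (T : SchemeType) (ℱ : Set (Finset Ordinal)) (α : Ordinal) (k : ℕ) : ℕ :=
  Set.ncard {ξ : Ordinal | ξ < α ∧ rho T ℱ α ξ ≤ k}

/-- `Δ(α,β)`: least `k` with `‖α‖_k ≠ ‖β‖_k`. -/
def deltaOrd (T : SchemeType) (ℱ : Set (Finset Ordinal)) (α β : Ordinal) : ℕ :=
  sInf {k | nrm T ℱ α k ≠ nrm T ℱ β k}

/-- `Ξ_α(k)`. -/
def Xi (T : SchemeType) (ℱ : Set (Finset Ordinal)) (α : Ordinal) (k : ℕ) : ℤ :=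
  if k = 0 then 0
  else if h : ∃ i : ℕ, ∃ F ∈ ℱ, ∃ D R, F.card = T.m k ∧ α ∈ F ∧
      IsDecomposition T ℱ (k - 1) F D R ∧ i < T.n k ∧ α ∈ D i ∧ α ∉ R
  then (h.choose : ℤ) else -1

/-- The `a`-th element of a finite set of ordinals, in increasing order. -/
def elt (A : Finset Ordinal) (a : ℕ) : Ordinal := (A.sort (· ≤ ·)).getD a 0

/-- The family `⟨D_0, …, D_{j-1}⟩` is Δ-captured at level `l`. -/
def DeltaCapturedFam (T : SchemeType) (ℱ : Set (Finset Ordinal)) (j : ℕ)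
    (D : ℕ → Finset Ordinal) (l : ℕ) : Prop :=
  ∃ R : Finset Ordinal,
    (∀ i < j, ∀ i' < j, (D i).card = (D i').card) ∧
    (∀ i < j, ∀ i' < j, i ≠ i' → D i ∩ D i' = R) ∧
    (∀ i < j, ∀ x ∈ R, ∀ y ∈ D i \ R, x < y) ∧
    (∀ i i', i < i' → i' < j → ∀ x ∈ D i \ R, ∀ y ∈ D i' \ R, x < y) ∧
    (∀ i < j, ∀ a < R.card, Xi T ℱ (elt (D i) a) l = -1) ∧
    (∀ i < j, ∀ a, R.card ≤ a → a < (D i).card → Xi T ℱ (elt (D i) a) l = (i : ℤ)) ∧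
    (∀ i < j, ∀ i' < j, i ≠ i' → ∀ a, R.card ≤ a → a < (D i).card →
      deltaOrd T ℱ (elt (D i) a) (elt (D i') a) = l)

/-- The family `⟨D_0, …, D_{j-1}⟩` is captured at level `l`. -/
def CapturedFam (T : SchemeType) (ℱ : Set (Finset Ordinal)) (j : ℕ)
    (D : ℕ → Finset Ordinal) (l : ℕ) : Prop :=
  DeltaCapturedFam T ℱ j D l ∧
  ∀ i < j, ∀ i' < j, i ≠ i' → ∀ a, (D i ∩ D i').card ≤ a → a < (D i).card →
    rho T ℱ (elt (D i) a) (elt (D i') a) = l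

/-- The ordered pair `⟨A, B⟩`, as a family. -/
def pairFam (A B : Finset Ordinal) : ℕ → Finset Ordinal := fun i => if i = 0 then A else B

/-- A pair of ordinals `α < β` is captured at level `l`, i.e. `⟨{α},{β}⟩` is. -/
def CapturedPair (T : SchemeType) (ℱ : Set (Finset Ordinal)) (α β : Ordinal) (l : ℕ) : Prop :=
  α < β ∧ Xi T ℱ α l = 0 ∧ Xi T ℱ β l = 1 ∧ deltaOrd T ℱ α β = l ∧ rho T ℱ α β = l

/-- `ℱ` is a 2-Δ-capturing scheme. -/
def TwoDeltaCapturing (T : SchemeType) (ℱ : Set (Finset Ordinal)) : Prop :=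
  ∀ 𝒮 : Set (Finset Ordinal), (∀ A ∈ 𝒮, A.Nonempty ∧ ↑A ⊆ Set.Iio omegaOne) →
    ¬ 𝒮.Countable →
    {l : ℕ | ∃ A ∈ 𝒮, ∃ B ∈ 𝒮, A ≠ B ∧ DeltaCapturedFam T ℱ 2 (pairFam A B) l}.Infinite

/-- `ℱ` is a 2-capturing scheme. -/
def TwoCapturing (T : SchemeType) (ℱ : Set (Finset Ordinal)) : Prop :=
  ∀ 𝒮 : Set (Finset Ordinal), (∀ A ∈ 𝒮, A.Nonempty ∧ ↑A ⊆ Set.Iio omegaOne) →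
    ¬ 𝒮.Countable →
    {l : ℕ | ∃ A ∈ 𝒮, ∃ B ∈ 𝒮, A ≠ B ∧ CapturedFam T ℱ 2 (pairFam A B) l}.Infinite

/-- `ℱ` is a fully Δ-capturing scheme. -/
def FullyDeltaCapturing (T : SchemeType) (ℱ : Set (Finset Ordinal)) : Prop :=
  ∀ 𝒮 : Set (Finset Ordinal), (∀ A ∈ 𝒮, A.Nonempty ∧ ↑A ⊆ Set.Iio omegaOne) →
    ¬ 𝒮.Countable →
    {l : ℕ | ∃ D : ℕ → Finset Ordinal, (∀ i < T.n l, D i ∈ 𝒮) ∧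
      (∀ i < T.n l, ∀ i' < T.n l, i ≠ i' → D i ≠ D i') ∧
      DeltaCapturedFam T ℱ (T.n l) D l}.Infinite

/-- `E` is an `n`-entangled subset of the linear order `X`. -/
def IsNEntangled {X : Type*} [LinearOrder X] (E : Set X) (n : ℕ) : Prop :=
  ¬ E.Countable ∧
  ∀ τ : Fin n → Fin 2, ∀ 𝒜 : Set (Fin n → X),
    (∀ a ∈ 𝒜, StrictMono a ∧ ∀ i, a i ∈ E) →
    (𝒜.Pairwise fun a b => ∀ i j, a i ≠ b j) →
    ¬ 𝒜.Countable →
    ∃ a ∈ 𝒜, ∃ b ∈ 𝒜, a ≠ b ∧ ∀ i, (a i < b i ↔ τ i = 0)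


/-- The sequence `e_α` (depending on a parameter `nn` and the chosen enumerations `C`). -/
def eSeq (T : SchemeType) (ℱ : Set (Finset Ordinal)) (C : ℕ → ℕ → Finset ℕ) (nn : ℕ)
    (α : Ordinal) : ℕ → ℤ := fun k =>
  if Xi T ℱ α k ≤ 0 then 0
  else if nrm T ℱ α (k - 1) ∈ C (k - 1) (Xi T ℱ α k).toNat ∨
      ((C (k - 1) (Xi T ℱ α k).toNat).card = nn ∧
        ∀ c ∈ C (k - 1) (Xi T ℱ α k).toNat, nrm T ℱ α (k - 1) < c)
  then Xi T ℱ α k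
  else -(Xi T ℱ α k)

/-- The sequence `o_α` (depending on the chosen enumerations `C`). -/
def oSeq (T : SchemeType) (ℱ : Set (Finset Ordinal)) (C : ℕ → ℕ → Finset ℕ)
    (α : Ordinal) : ℕ → ℤ := fun k =>
  if Xi T ℱ α k ≤ 0 then 0
  else if nrm T ℱ α (k - 1) ∈ C (k - 1) (Xi T ℱ α k).toNat
  then Xi T ℱ α k
  else -(Xi T ℱ α k)

/-- `C` is an enumeration `⟨C^k_i⟩_{0<i<n_{k+1}}` (possibly with repetitions) of all subsets of
`m_k ∖ r_{k+1}` of cardinality at most `nn`. -/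
def IsGoodEnum (T : SchemeType) (nn : ℕ) (C : ℕ → ℕ → Finset ℕ) : Prop :=
  (∀ k, ∀ i, 0 < i → i < T.n (k + 1) →
    C k i ⊆ Finset.Ico (T.r (k + 1)) (T.m k) ∧ (C k i).card ≤ nn) ∧
  (∀ k, ∀ s : Finset ℕ, s ⊆ Finset.Ico (T.r (k + 1)) (T.m k) → s.card ≤ nn →
    ∃ i, 0 < i ∧ i < T.n (k + 1) ∧ C k i = s)

section ConstructionSchemes

universe u

variable {T : SchemeType} {ℱ : Set (Finset Ordinal.{u})}

theorem SchemeType.m_strictMono (T : SchemeType) : StrictMono T.m := by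
  refine strictMono_nat_of_lt_succ fun k => ?_
  have h1 := T.m_succ k
  have h2 := T.r_lt k
  have h3 : (T.m k - T.r (k + 1)) * 2 ≤ (T.m k - T.r (k + 1)) * T.n (k + 1) :=
    Nat.mul_le_mul_left _ (T.n_ge k)
  omega

namespace IsDecomposition

variable {k : ℕ} {F R : Finset Ordinal.{u}} {D : ℕ → Finset Ordinal.{u}}

theorem mem_iff (hD : IsDecomposition T ℱ k F D R) {x : Ordinal.{u}} :
    x ∈ F ↔ ∃ i < T.n (k + 1), x ∈ D i := by
  rw [hD.2.1]; simp

theorem root_subset (hD : IsDecomposition T ℱ k F D R) {i : ℕ} (hi : i < T.n (k + 1)) :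
    R ⊆ D i := by
  have h2 := T.n_ge k
  obtain ⟨j, hj, hij⟩ : ∃ j < T.n (k + 1), i ≠ j := by
    by_cases h : i = 0
    · exact ⟨1, by omega, by omega⟩
    · exact ⟨0, by omega, h⟩
  rw [← hD.2.2.2.1 i hi j hj hij]
  exact Finset.inter_subset_left

theorem card_sdiff_root (hD : IsDecomposition T ℱ k F D R) {i : ℕ} (hi : i < T.n (k + 1)) :
    (D i \ R).card = T.m k - T.r (k + 1) := by
  rw [Finset.card_sdiff_of_subset (hD.root_subset hi), (hD.1 i hi).2, hD.2.2.1]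

theorem filter_lt_of_mem_root (hD : IsDecomposition T ℱ k F D R) {α : Ordinal.{u}}
    (hα : α ∈ R) {i : ℕ} (hi : i < T.n (k + 1)) :
    (D i).filter (· < α) = R.filter (· < α) := by
  ext x
  simp only [Finset.mem_filter]
  refine ⟨fun ⟨h1, h2⟩ => ⟨?_, h2⟩, fun ⟨h1, h2⟩ => ⟨hD.root_subset hi h1, h2⟩⟩
  by_contra h
  exact lt_asymm h2 (hD.2.2.2.2.1 i hi α hα x (Finset.mem_sdiff.2 ⟨h1, h⟩))

theorem filter_lt_eq_of_mem_root (hD : IsDecomposition T ℱ k F D R) {α : Ordinal.{u}}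
    (hα : α ∈ R) : F.filter (· < α) = R.filter (· < α) := by
  ext x
  rw [Finset.mem_filter, hD.mem_iff]
  constructor
  · rintro ⟨⟨i, hi, hx⟩, hlt⟩
    rw [← hD.filter_lt_of_mem_root hα hi]
    exact Finset.mem_filter.2 ⟨hx, hlt⟩
  · intro hx
    obtain ⟨hx, hlt⟩ := Finset.mem_filter.1 hx
    have h0 : 0 < T.n (k + 1) := by have := T.n_ge k; omega
    exact ⟨⟨0, h0, hD.root_subset h0 hx⟩, hlt⟩

theorem card_filter_lt (hD : IsDecomposition T ℱ k F D R) {α : Ordinal.{u}} {i : ℕ}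
    (hi : i < T.n (k + 1)) (hα : α ∈ D i) (hR : α ∉ R) :
    (F.filter (· < α)).card =
      ((D i).filter (· < α)).card + i * (T.m k - T.r (k + 1)) := by
  have hαi : α ∈ D i \ R := Finset.mem_sdiff.2 ⟨hα, hR⟩
  have hF : F.filter (· < α) =
      (D i).filter (· < α) ∪ (Finset.range i).biUnion fun j => D j \ R := by
    ext x
    rw [Finset.mem_filter, hD.mem_iff, Finset.mem_union, Finset.mem_filter, Finset.mem_biUnion]
    constructor
    · rintro ⟨⟨j, hj, hx⟩, hlt⟩
      by_cases hxR : x ∈ R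
      · exact Or.inl ⟨hD.root_subset hi hxR, hlt⟩
      have hxj : x ∈ D j \ R := Finset.mem_sdiff.2 ⟨hx, hxR⟩
      rcases lt_trichotomy j i with h | h | h
      · exact Or.inr ⟨j, Finset.mem_range.2 h, hxj⟩
      · exact Or.inl ⟨h ▸ hx, hlt⟩
      · exact absurd (hD.2.2.2.2.2 i j h hj α hαi x hxj) (lt_asymm hlt)
    · rintro (⟨hx, hlt⟩ | ⟨j, hj, hx⟩)
      · exact ⟨⟨i, hi, hx⟩, hlt⟩
      · rw [Finset.mem_range] at hj
        exact ⟨⟨j, hj.trans hi, (Finset.mem_sdiff.1 hx).1⟩,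
          hD.2.2.2.2.2 j i hj hi x hx α hαi⟩
  have hdisj : ∀ j < T.n (k + 1), ∀ j' < T.n (k + 1), j ≠ j' → Disjoint (D j) (D j' \ R) := by
    intro j hj j' hj' hne
    rw [Finset.disjoint_left]
    intro x hx hx'
    rw [Finset.mem_sdiff] at hx'
    apply hx'.2
    rw [← hD.2.2.2.1 j hj j' hj' hne]
    exact Finset.mem_inter.2 ⟨hx, hx'.1⟩
  rw [hF, Finset.card_union_of_disjoint, Finset.card_biUnion]
  · congr 1
    rw [Finset.sum_congr rfl fun j hj =>
      hD.card_sdiff_root ((Finset.mem_range.1 hj).trans hi)]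
    simp
  · intro j hj j' hj' hne
    rw [Finset.mem_coe, Finset.mem_range] at hj hj'
    exact (hdisj j (hj.trans hi) j' (hj'.trans hi) hne).mono_left Finset.sdiff_subset
  · rw [Finset.disjoint_biUnion_right]
    intro j hj
    rw [Finset.mem_range] at hj
    exact (hdisj i hi j (hj.trans hi) hj.ne').mono_left (Finset.filter_subset _ _)

end IsDecomposition

theorem natCast_lt_omegaOne (n : ℕ) : (n : Ordinal.{u}) < omegaOne := by
  rw [omegaOne, Cardinal.lt_ord, Ordinal.card_nat]
  exact Cardinal.natCast_lt_aleph0.trans_le (Cardinal.aleph0_le_aleph 1)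

namespace IsConstructionScheme

theorem exists_mem_level_of_mem (hS : IsConstructionScheme T ℱ) {α : Ordinal.{u}} (k d : ℕ) :
    ∀ F ∈ ℱ, F.card = T.m (k + d) → α ∈ F → ∃ E ∈ ℱ, E.card = T.m k ∧ α ∈ E := by
  induction d with
  | zero => exact fun F hF hc hα => ⟨F, hF, hc, hα⟩
  | succ d ih =>
    intro F hF hc hα
    obtain ⟨D, R, hD⟩ := hS.decomp (k + d) F hF hc
    obtain ⟨i, hi, hx⟩ := hD.mem_iff.1 hα
    exact ih (D i) (hD.1 i hi).1 (hD.1 i hi).2 hx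

theorem exists_mem_level (hS : IsConstructionScheme T ℱ) {α : Ordinal.{u}} (hα : α < omegaOne)
    (k : ℕ) : ∃ F ∈ ℱ, F.card = T.m k ∧ α ∈ F := by
  obtain ⟨F, hF, hAF⟩ := hS.cofinal
    (insert α ((Finset.range (T.m k)).image fun n : ℕ => (n : Ordinal.{u}))) (by
      intro x hx
      rw [Finset.mem_coe, Finset.mem_insert, Finset.mem_image] at hx
      rcases hx with rfl | ⟨n, -, rfl⟩
      · exact hα
      · exact natCast_lt_omegaOne n)
  obtain ⟨l, hl⟩ := hS.card_eq F hF
  have hle : T.m k ≤ T.m l := by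
    rw [← hl]
    calc T.m k = ((Finset.range (T.m k)).image fun n : ℕ => (n : Ordinal.{u})).card := by
          rw [Finset.card_image_of_injective _ Nat.cast_injective, Finset.card_range]
      _ ≤ F.card := Finset.card_le_card ((Finset.subset_insert _ _).trans hAF)
  obtain ⟨d, rfl⟩ := Nat.exists_eq_add_of_le (T.m_strictMono.le_iff_le.1 hle)
  exact hS.exists_mem_level_of_mem k d F hF hl (hAF (Finset.mem_insert_self _ _))

theorem exists_pair_mem (hS : IsConstructionScheme T ℱ) {α β : Ordinal.{u}} (hα : α < omegaOne)
    (hβ : β < omegaOne) : ∃ k, ∃ F ∈ ℱ, F.card = T.m k ∧ α ∈ F ∧ β ∈ F := by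
  obtain ⟨F, hF, hAF⟩ := hS.cofinal {α, β} (by
    intro x hx
    rw [Finset.mem_coe, Finset.mem_insert, Finset.mem_singleton] at hx
    rcases hx with rfl | rfl <;> assumption)
  obtain ⟨k, hk⟩ := hS.card_eq F hF
  exact ⟨k, F, hF, hk, hAF (by simp), hAF (by simp)⟩

theorem mem_of_lt_of_mem (hS : IsConstructionScheme T ℱ) {E : Finset Ordinal.{u}} {j : ℕ}
    (hE : E ∈ ℱ) (hEc : E.card = T.m j) {a b : Ordinal.{u}} (ha : a ∈ E) (hb : b ∈ E)
    (hba : b < a) (d : ℕ) : ∀ F ∈ ℱ, F.card = T.m (j + d) → a ∈ F → b ∈ F := by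
  induction d with
  | zero =>
    intro F hF hFc haF
    exact (Finset.mem_inter.1 ((hS.inter_initSeg j E hE F hF hEc hFc).1 a
      (Finset.mem_inter.2 ⟨ha, haF⟩) b hb hba)).2
  | succ d ih =>
    intro F hF hFc haF
    obtain ⟨D, R, hD⟩ := hS.decomp (j + d) F hF hFc
    obtain ⟨i, hi, hx⟩ := hD.mem_iff.1 haF
    exact hD.mem_iff.2 ⟨i, hi, ih (D i) (hD.1 i hi).1 (hD.1 i hi).2 hx⟩

theorem rho_le_iff (hS : IsConstructionScheme T ℱ) {F : Finset Ordinal.{u}} {k : ℕ}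
    (hF : F ∈ ℱ) (hFc : F.card = T.m k) {α ξ : Ordinal.{u}} (hα : α ∈ F) (hξ : ξ < α) :
    rho T ℱ α ξ ≤ k ↔ ξ ∈ F := by
  refine ⟨fun h => ?_, fun h => Nat.sInf_le ⟨F, hF, hFc, hα, h⟩⟩
  have hαω : α < omegaOne := hS.mem_subset F hF hα
  obtain ⟨E, hE, hEc, hαE, hξE⟩ := Nat.sInf_mem (hS.exists_pair_mem hαω (hξ.trans hαω))
  obtain ⟨d, hd⟩ := Nat.exists_eq_add_of_le h
  exact hS.mem_of_lt_of_mem hE hEc hαE hξE hξ d F hF (by rw [hFc, hd]; rfl) hα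

theorem nrm_eq_card (hS : IsConstructionScheme T ℱ) {F : Finset Ordinal.{u}} {k : ℕ}
    (hF : F ∈ ℱ) (hFc : F.card = T.m k) {α : Ordinal.{u}} (hα : α ∈ F) :
    nrm T ℱ α k = (F.filter (· < α)).card := by
  rw [nrm, ← Set.ncard_coe_finset]
  congr 1
  ext ξ
  rw [Finset.mem_coe, Finset.mem_filter, Set.mem_ofPred_eq, and_comm]
  exact and_congr_left fun h => hS.rho_le_iff hF hFc hα h

theorem nrm_lt (hS : IsConstructionScheme T ℱ) {α : Ordinal.{u}} (hα : α < omegaOne) (k : ℕ) :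
    nrm T ℱ α k < T.m k := by
  obtain ⟨F, hF, hFc, hαF⟩ := hS.exists_mem_level hα k
  rw [hS.nrm_eq_card hF hFc hαF, ← hFc]
  exact Finset.card_lt_card (Finset.filter_ssubset.2 ⟨α, hαF, lt_irrefl α⟩)

theorem nrm_zero (hS : IsConstructionScheme T ℱ) {α : Ordinal.{u}} (hα : α < omegaOne) :
    nrm T ℱ α 0 = 0 := by
  have := hS.nrm_lt hα 0
  rw [T.m_zero] at this
  omega

theorem nrm_lt_nrm (hS : IsConstructionScheme T ℱ) {F : Finset Ordinal.{u}} {k : ℕ}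
    (hF : F ∈ ℱ) (hFc : F.card = T.m k) {α β : Ordinal.{u}} (hα : α ∈ F) (hβ : β ∈ F)
    (h : α < β) : nrm T ℱ α k < nrm T ℱ β k := by
  rw [hS.nrm_eq_card hF hFc hα, hS.nrm_eq_card hF hFc hβ]
  refine Finset.card_lt_card (Finset.ssubset_iff_of_subset ?_ |>.2 ⟨α, ?_, ?_⟩)
  · intro x hx
    rw [Finset.mem_filter] at hx ⊢
    exact ⟨hx.1, hx.2.trans h⟩
  · exact Finset.mem_filter.2 ⟨hα, h⟩
  · exact fun hx => lt_irrefl α (Finset.mem_filter.1 hx).2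

theorem exists_nrm_ne (hS : IsConstructionScheme T ℱ) {α β : Ordinal.{u}} (hα : α < omegaOne)
    (hβ : β < omegaOne) (hne : α ≠ β) : ∃ k, nrm T ℱ α k ≠ nrm T ℱ β k := by
  obtain ⟨k, F, hF, hFc, hαF, hβF⟩ := hS.exists_pair_mem hα hβ
  refine ⟨k, ?_⟩
  rcases lt_or_gt_of_ne hne with h | h
  · exact (hS.nrm_lt_nrm hF hFc hαF hβF h).ne
  · exact (hS.nrm_lt_nrm hF hFc hβF hαF h).ne'

/-- `Ξ_α(k+1)` and `‖α‖_k` together determine `‖α‖_{k+1}`. -/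
theorem Xi_succ_cases (hS : IsConstructionScheme T ℱ) {α : Ordinal.{u}} (hα : α < omegaOne)
    (k : ℕ) :
    (Xi T ℱ α (k + 1) = -1 ∧ nrm T ℱ α (k + 1) = nrm T ℱ α k ∧
      nrm T ℱ α k < T.r (k + 1)) ∨
    ∃ i : ℕ, Xi T ℱ α (k + 1) = i ∧
      nrm T ℱ α (k + 1) = nrm T ℱ α k + i * (T.m k - T.r (k + 1)) ∧
      T.r (k + 1) ≤ nrm T ℱ α k := by
  unfold Xi
  rw [if_neg k.succ_ne_zero]
  split_ifs with h
  · right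
    refine ⟨h.choose, rfl, ?_⟩
    obtain ⟨F, hF, D, R, hFc, hαF, hD, hi, hαD, hαR⟩ := h.choose_spec
    rw [Nat.add_sub_cancel] at hD
    rw [hS.nrm_eq_card hF hFc hαF, hS.nrm_eq_card (hD.1 _ hi).1 (hD.1 _ hi).2 hαD]
    refine ⟨hD.card_filter_lt hi hαD hαR, ?_⟩
    rw [← hD.2.2.1]
    exact Finset.card_le_card fun x hx => Finset.mem_filter.2 ⟨hD.root_subset hi hx,
      hD.2.2.2.2.1 _ hi x hx α (Finset.mem_sdiff.2 ⟨hαD, hαR⟩)⟩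
  · left
    obtain ⟨F, hF, hFc, hαF⟩ := hS.exists_mem_level hα (k + 1)
    obtain ⟨D, R, hD⟩ := hS.decomp k F hF hFc
    obtain ⟨i, hi, hαD⟩ := hD.mem_iff.1 hαF
    have hαR : α ∈ R := by
      by_contra hαR
      exact h ⟨i, F, hF, D, R, hFc, hαF, hD, hi, hαD, hαR⟩
    rw [hS.nrm_eq_card hF hFc hαF, hS.nrm_eq_card (hD.1 i hi).1 (hD.1 i hi).2 hαD,
      hD.filter_lt_eq_of_mem_root hαR, hD.filter_lt_of_mem_root hαR hi, ← hD.2.2.1]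
    exact ⟨rfl, rfl, Finset.card_lt_card (Finset.filter_ssubset.2 ⟨α, hαR, lt_irrefl α⟩)⟩

theorem nrm_eq_and_Xi_eq_of_nrm_succ_eq (hS : IsConstructionScheme T ℱ) {α β : Ordinal.{u}}
    (hα : α < omegaOne) (hβ : β < omegaOne) {k : ℕ}
    (h : nrm T ℱ α (k + 1) = nrm T ℱ β (k + 1)) :
    nrm T ℱ α k = nrm T ℱ β k ∧ Xi T ℱ α (k + 1) = Xi T ℱ β (k + 1) := by
  have ha := hS.nrm_lt hα k
  have hb := hS.nrm_lt hβ k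
  rcases hS.Xi_succ_cases hα k with ⟨h1, h2, h3⟩ | ⟨i, h1, h2, h3⟩ <;>
    rcases hS.Xi_succ_cases hβ k with ⟨h1', h2', h3'⟩ | ⟨i', h1', h2', h3'⟩
  · exact ⟨by omega, by rw [h1, h1']⟩
  · omega
  · omega
  · have hii : i = i' := by
      rcases lt_trichotomy i i' with hlt | heq | hlt
      · have := Nat.mul_le_mul_right (T.m k - T.r (k + 1)) (Nat.succ_le_of_lt hlt)
        rw [Nat.succ_mul] at this
        omega
      · exact heq
      · have := Nat.mul_le_mul_right (T.m k - T.r (k + 1)) (Nat.succ_le_of_lt hlt)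
        rw [Nat.succ_mul] at this
        omega
    subst hii
    exact ⟨by omega, by rw [h1, h1']⟩

theorem Xi_ne_of_nrm_succ_ne (hS : IsConstructionScheme T ℱ) {α β : Ordinal.{u}}
    (hα : α < omegaOne) (hβ : β < omegaOne) {k : ℕ} (hk : nrm T ℱ α k = nrm T ℱ β k)
    (h : nrm T ℱ α (k + 1) ≠ nrm T ℱ β (k + 1)) :
    Xi T ℱ α (k + 1) ≠ Xi T ℱ β (k + 1) ∧ 0 ≤ Xi T ℱ α (k + 1) ∧ 0 ≤ Xi T ℱ β (k + 1) := by
  rcases hS.Xi_succ_cases hα k with ⟨h1, h2, h3⟩ | ⟨i, h1, h2, h3⟩ <;>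
    rcases hS.Xi_succ_cases hβ k with ⟨h1', h2', h3'⟩ | ⟨i', h1', h2', h3'⟩
  · omega
  · omega
  · omega
  · refine ⟨fun heq => h ?_, by omega, by omega⟩
    have : i = i' := by omega
    rw [h2, h2', hk, this]

theorem exists_deltaOrd_eq_succ (hS : IsConstructionScheme T ℱ) {α β : Ordinal.{u}}
    (hα : α < omegaOne) (hβ : β < omegaOne) (hne : α ≠ β) :
    ∃ d, deltaOrd T ℱ α β = d + 1 ∧ nrm T ℱ α (d + 1) ≠ nrm T ℱ β (d + 1) ∧
      ∀ k ≤ d, nrm T ℱ α k = nrm T ℱ β k := by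
  have hmem : nrm T ℱ α (deltaOrd T ℱ α β) ≠ nrm T ℱ β (deltaOrd T ℱ α β) :=
    Nat.sInf_mem (hS.exists_nrm_ne hα hβ hne)
  have hlt : ∀ k < deltaOrd T ℱ α β, nrm T ℱ α k = nrm T ℱ β k := fun k hk =>
    not_not.1 (Nat.notMem_of_lt_sInf hk)
  cases hd : deltaOrd T ℱ α β with
  | zero =>
    rw [hd, hS.nrm_zero hα, hS.nrm_zero hβ] at hmem
    exact absurd rfl hmem
  | succ d =>
    rw [hd] at hmem hlt
    exact ⟨d, rfl, hmem, fun k hk => hlt k (Nat.lt_succ_of_le hk)⟩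

/-- A sequence whose value at `k + 1` is computed from `Ξ_α(k+1)` and `‖α‖_k` and equals
`± Ξ_α(k+1)` when `Ξ_α(k+1) ≥ 0` first distinguishes `α` and `β` at `Δ(α,β)`. -/
theorem first_difference_eq_deltaOrd (hS : IsConstructionScheme T ℱ)
    (s : Ordinal.{u} → ℕ → ℤ) (h0 : ∀ α, s α 0 = 0)
    (hdet : ∀ α β k, Xi T ℱ α (k + 1) = Xi T ℱ β (k + 1) → nrm T ℱ α k = nrm T ℱ β k →
      s α (k + 1) = s β (k + 1))
    (habs : ∀ α k, 0 ≤ Xi T ℱ α k → |s α k| = Xi T ℱ α k)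
    {α β : Ordinal.{u}} (hα : α < omegaOne) (hβ : β < omegaOne) (hne : α ≠ β) :
    (∃ k, s α k ≠ s β k) ∧ sInf {k | s α k ≠ s β k} = deltaOrd T ℱ α β := by
  obtain ⟨d, hd, hne', heq⟩ := hS.exists_deltaOrd_eq_succ hα hβ hne
  obtain ⟨hX, hXα, hXβ⟩ := hS.Xi_ne_of_nrm_succ_ne hα hβ (heq d le_rfl) hne'
  have hmem : s α (d + 1) ≠ s β (d + 1) := by
    intro h
    apply hX
    rw [← habs α _ hXα, ← habs β _ hXβ, h]
  refine ⟨⟨d + 1, hmem⟩, hd ▸ le_antisymm (Nat.sInf_le hmem) ?_⟩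
  refine le_csInf ⟨d + 1, hmem⟩ fun k hk => ?_
  by_contra! hlt
  apply hk
  cases k with
  | zero => rw [h0, h0]
  | succ k =>
    obtain ⟨h1, h2⟩ := hS.nrm_eq_and_Xi_eq_of_nrm_succ_eq hα hβ
      (heq (k + 1) (Nat.le_of_lt_succ hlt))
    exact hdet α β k h2 h1

end IsConstructionScheme

theorem Xi_zero (α : Ordinal.{u}) : Xi T ℱ α 0 = 0 := if_pos rfl

theorem abs_eSeq (C : ℕ → ℕ → Finset ℕ) (nn : ℕ) (α : Ordinal.{u}) (k : ℕ)
    (h : 0 ≤ Xi T ℱ α k) : |eSeq T ℱ C nn α k| = Xi T ℱ α k := by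
  unfold eSeq
  split_ifs with h1
  · rw [abs_zero]; exact le_antisymm h h1
  · exact abs_of_nonneg h
  · rw [abs_neg, abs_of_nonneg h]

theorem abs_oSeq (C : ℕ → ℕ → Finset ℕ) (α : Ordinal.{u}) (k : ℕ)
    (h : 0 ≤ Xi T ℱ α k) : |oSeq T ℱ C α k| = Xi T ℱ α k := by
  unfold oSeq
  split_ifs with h1
  · rw [abs_zero]; exact le_antisymm h h1
  · exact abs_of_nonneg h
  · rw [abs_neg, abs_of_nonneg h]

end ConstructionSchemes

section SequenceSpaces

variable {ι : Type*} {S : Set ι} {f g : ι → ℕ → ℤ}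

theorem apply_eq_of_forall_le_eq
    (h : ∀ a ∈ S, ∀ b ∈ S, a ≠ b → ((∃ k, f a k ≠ f b k) ∧ (∃ k, g a k ≠ g b k)) ∧
      sInf {k | f a k ≠ f b k} = sInf {k | g a k ≠ g b k}) :
    ∀ a ∈ S, ∀ b ∈ S, ∀ k, (∀ j ≤ k, f a j = f b j) → g a k = g b k := by
  intro a ha b hb k hk
  by_cases hab : a = b
  · rw [hab]
  obtain ⟨⟨hf, -⟩, he⟩ := h a ha b hb hab
  by_contra hg
  have h1 : sInf {k | f a k ≠ f b k} ≤ k := he ▸ Nat.sInf_le hg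
  exact Nat.sInf_mem hf (hk _ h1)

theorem exists_continuousMap_image
    (h : ∀ a ∈ S, ∀ b ∈ S, ∀ k, (∀ j ≤ k, f a j = f b j) → g a k = g b k) :
    ∃ φ : C(f '' S, g '' S), ∀ a, ∀ ha : a ∈ S,
      φ ⟨f a, Set.mem_image_of_mem f ha⟩ = ⟨g a, Set.mem_image_of_mem g ha⟩ := by
  choose p hpS hp using fun x : f '' S => x.2
  refine ⟨⟨fun x => ⟨g (p x), Set.mem_image_of_mem g (hpS x)⟩, ?_⟩, fun a ha => ?_⟩
  · refine Continuous.subtype_mk (continuous_pi fun k => ?_) _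
    refine (IsLocallyConstant.iff_exists_open _).2 (fun x => ?_) |>.continuous
    refine ⟨⋂ j ∈ Finset.range (k + 1), {y : f '' S | y.1 j = x.1 j},
      isOpen_biInter_finset fun j _ => ?_, ?_, fun y hy => ?_⟩
    · exact (isOpen_discrete ({x.1 j} : Set ℤ)).preimage
        (show Continuous fun y : f '' S => y.1 j from
          (continuous_apply j).comp continuous_subtype_val)
    · simp
    · refine h _ (hpS y) _ (hpS x) k fun j hj => ?_
      rw [hp, hp]
      exact Set.mem_iInter₂.1 hy j (Finset.mem_range.2 (Nat.lt_succ_of_le hj))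
  · refine Subtype.ext (funext fun k => h _ (hpS _) a ha k fun j _ => ?_)
    rw [hp]

theorem exists_homeomorph_image
    (h : ∀ a ∈ S, ∀ b ∈ S, a ≠ b → ((∃ k, f a k ≠ f b k) ∧ (∃ k, g a k ≠ g b k)) ∧
      sInf {k | f a k ≠ f b k} = sInf {k | g a k ≠ g b k}) :
    ∃ φ : f '' S ≃ₜ g '' S, ∀ a, ∀ ha : a ∈ S,
      (φ ⟨f a, Set.mem_image_of_mem f ha⟩).val = g a := by
  obtain ⟨φ, hφ⟩ := exists_continuousMap_image (apply_eq_of_forall_le_eq h)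
  obtain ⟨ψ, hψ⟩ := exists_continuousMap_image (apply_eq_of_forall_le_eq (f := g) (g := f)
    fun a ha b hb hab => ⟨(h a ha b hb hab).1.symm, (h a ha b hb hab).2.symm⟩)
  refine ⟨⟨⟨φ, ψ, ?_, ?_⟩, φ.continuous, ψ.continuous⟩,
    fun a ha => congrArg Subtype.val (hφ a ha)⟩
  · rintro ⟨_, a, ha, rfl⟩
    rw [hφ a ha, hψ a ha]
  · rintro ⟨_, a, ha, rfl⟩
    rw [hψ a ha, hφ a ha]

end SequenceSpaces

/-- For a construction scheme with `n_{k+1} ≥ 2^{m_k}`: for `α ≠ β` below `ω₁` the least points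
of disagreement of `e_α, e_β`, of `o_α, o_β` and of `Ξ_α, Ξ_β` all exist and equal `Δ(α,β)`;
hence `α ↦ e_α`, `α ↦ o_α`, `α ↦ Ξ_α` are injective, and the maps `Ξ_α ↦ e_α`, `Ξ_α ↦ o_α` are
homeomorphisms between `{Ξ_α}`, `{e_α}` and `{o_α}` as subspaces of `ℤ^ω` with the product
topology (`ℤ` discrete). -/
theorem stmt7 (T : SchemeType) (ℱ : Set (Finset Ordinal))
    (hS : IsConstructionScheme T ℱ)
    (hgrow : ∀ k, 2 ^ T.m k ≤ T.n (k + 1))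
    (nn : ℕ) (hn : 1 ≤ nn) (C : ℕ → ℕ → Finset ℕ) (hC : IsGoodEnum T nn C) :
    (∀ α < omegaOne, ∀ β < omegaOne, α ≠ β →
      ((∃ k, eSeq T ℱ C nn α k ≠ eSeq T ℱ C nn β k) ∧
        sInf {k | eSeq T ℱ C nn α k ≠ eSeq T ℱ C nn β k} = deltaOrd T ℱ α β) ∧
      ((∃ k, oSeq T ℱ C α k ≠ oSeq T ℱ C β k) ∧
        sInf {k | oSeq T ℱ C α k ≠ oSeq T ℱ C β k} = deltaOrd T ℱ α β) ∧
      ((∃ k, Xi T ℱ α k ≠ Xi T ℱ β k) ∧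
        sInf {k | Xi T ℱ α k ≠ Xi T ℱ β k} = deltaOrd T ℱ α β)) ∧
    (∀ α < omegaOne, ∀ β < omegaOne, eSeq T ℱ C nn α = eSeq T ℱ C nn β → α = β) ∧
    (∀ α < omegaOne, ∀ β < omegaOne, oSeq T ℱ C α = oSeq T ℱ C β → α = β) ∧
    (∀ α < omegaOne, ∀ β < omegaOne, (fun k => Xi T ℱ α k) = (fun k => Xi T ℱ β k) → α = β) ∧
    (∃ f : ((fun α => fun k => Xi T ℱ α k) '' Set.Iio omegaOne : Set (ℕ → ℤ)) ≃ₜ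
        ((fun α => eSeq T ℱ C nn α) '' Set.Iio omegaOne : Set (ℕ → ℤ)),
      ∀ α, ∀ h : α ∈ Set.Iio omegaOne,
        (f ⟨fun k => Xi T ℱ α k, Set.mem_image_of_mem _ h⟩).val = eSeq T ℱ C nn α) ∧
    (∃ g : ((fun α => fun k => Xi T ℱ α k) '' Set.Iio omegaOne : Set (ℕ → ℤ)) ≃ₜ
        ((fun α => oSeq T ℱ C α) '' Set.Iio omegaOne : Set (ℕ → ℤ)),
      ∀ α, ∀ h : α ∈ Set.Iio omegaOne,
        (g ⟨fun k => Xi T ℱ α k, Set.mem_image_of_mem _ h⟩).val = oSeq T ℱ C α) := by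
  have he := fun {α β : Ordinal} => hS.first_difference_eq_deltaOrd (eSeq T ℱ C nn)
    (fun α => if_pos (Xi_zero α).le)
    (fun α β k h1 h2 => by simp only [eSeq, Nat.add_sub_cancel, h1, h2])
    (abs_eSeq C nn) (α := α) (β := β)
  have ho := fun {α β : Ordinal} => hS.first_difference_eq_deltaOrd (oSeq T ℱ C)
    (fun α => if_pos (Xi_zero α).le)
    (fun α β k h1 h2 => by simp only [oSeq, Nat.add_sub_cancel, h1, h2])
    (abs_oSeq C) (α := α) (β := β)
  have hX := fun {α β : Ordinal} => hS.first_difference_eq_deltaOrd (Xi T ℱ)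
    Xi_zero (fun α β k h _ => h) (fun α k h => abs_of_nonneg h) (α := α) (β := β)
  refine ⟨fun α hα β hβ hne => ⟨he hα hβ hne, ho hα hβ hne, hX hα hβ hne⟩,
    fun α hα β hβ h => ?_, fun α hα β hβ h => ?_, fun α hα β hβ h => ?_, ?_, ?_⟩
  · by_contra hne
    obtain ⟨k, hk⟩ := (he hα hβ hne).1
    exact hk (congrFun h k)
  · by_contra hne
    obtain ⟨k, hk⟩ := (ho hα hβ hne).1
    exact hk (congrFun h k)
  · by_contra hne
    obtain ⟨k, hk⟩ := (hX hα hβ hne).1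
    exact hk (congrFun h k)
  · exact exists_homeomorph_image fun α hα β hβ hne =>
      ⟨⟨(hX hα hβ hne).1, (he hα hβ hne).1⟩,
        (hX hα hβ hne).2.trans (he hα hβ hne).2.symm⟩
  · exact exists_homeomorph_image fun α hα β hβ hne =>
      ⟨⟨(hX hα hβ hne).1, (ho hα hβ hne).1⟩,
        (hX hα hβ hne).2.trans (ho hα hβ hne).2.symm⟩

end
end

section
/- Let ℱ be a 2-capturing construction scheme, n ≥ 1, 𝒜 an uncountable set, ζ : 𝒜 → ω₁ injective, and A ↦ E_A an assignment of 2n-element subsets of ℝ to members of 𝒜 with pairwise disjoint images, such that for all distinct A, B ∈ 𝒜: if the pair {ζ(A), ζ(B)} is captured at some level then type(E_A, E_B) is not constant. Let ℚ be the partial order, under reverse inclusion, of all finite p ⊆ 𝒜 such that type(E_A, E_B) is not constant for any two distinct A, B ∈ p. Then for every uncountable ℬ ⊆ ℚ and every injective ν : ℬ → ω₁ there are distinct compatible p, q ∈ ℬ such that the pair {ν(p), ν(q)} is captured at some level; in particular ℚ has no uncountable antichain. -/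
noncomputable section

open scoped Classical

universe u

/-- The unordered pair `{a, b}` is captured at some level. -/
def CapPairSome (T : SchemeType) (ℱ : Set (Finset Ordinal)) (a b : Ordinal) : Prop :=
  ∃ l, CapturedPair T ℱ a b l ∨ CapturedPair T ℱ b a l

/-- `type(u,v)` is not constant. -/
def NonConstType {m : ℕ} (u v : Fin m → ℝ) : Prop :=
  ¬ (∀ i, u i < v i) ∧ ¬ (∀ i, v i < u i)

/-- Conditions of the forcing `ℚ`: finite `p ⊆ 𝒜` with `type(E_A, E_B)` non-constant for any
two distinct `A, B ∈ p`; `ℚ` is ordered by reverse inclusion. -/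
def QcondC {ι : Type u} {m : ℕ} (𝒜 : Set ι) (E : ι → Fin m → ℝ) (p : Finset ι) : Prop :=
  ↑p ⊆ 𝒜 ∧ ∀ A ∈ p, ∀ B ∈ p, A ≠ B → NonConstType (E A) (E B)

/-- The position of `x` in the increasing enumeration of `S`. -/
def pos (S : Finset Ordinal) (x : Ordinal) : ℕ := (S.sort (· ≤ ·)).idxOf x

theorem pos_lt_card {S : Finset Ordinal} {x : Ordinal} (hx : x ∈ S) : pos S x < S.card := by
  have h : pos S x < (S.sort (· ≤ ·)).length :=
    List.idxOf_lt_length_iff.2 ((Finset.mem_sort _).2 hx)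
  simpa using h

theorem elt_pos {S : Finset Ordinal} {x : Ordinal} (hx : x ∈ S) : elt S (pos S x) = x := by
  have h : pos S x < (S.sort (· ≤ ·)).length := by simpa using pos_lt_card hx
  unfold elt
  rw [List.getD_eq_getElem _ _ h]
  exact List.getElem_idxOf h

theorem elt_mem {S : Finset Ordinal} {a : ℕ} (ha : a < S.card) : elt S a ∈ S := by
  have h : a < (S.sort (· ≤ ·)).length := by simpa using ha
  unfold elt
  rw [List.getD_eq_getElem _ _ h]
  exact (Finset.mem_sort (· ≤ ·)).1 (List.getElem_mem h)

theorem sort_eq_append {A R : Finset Ordinal} (hRA : R ⊆ A)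
    (hlt : ∀ x ∈ R, ∀ y ∈ A \ R, x < y) :
    A.sort (· ≤ ·) = R.sort (· ≤ ·) ++ (A \ R).sort (· ≤ ·) := by
  have hs : (R.sort (· ≤ ·) ++ (A \ R).sort (· ≤ ·)).Pairwise (· ≤ ·) := by
    refine List.pairwise_append.2 ⟨Finset.pairwise_sort _ _, Finset.pairwise_sort _ _, ?_⟩
    intro x hx y hy
    exact (hlt x ((Finset.mem_sort _).1 hx) y ((Finset.mem_sort _).1 hy)).le
  refine List.Perm.eq_of_pairwise (fun _ _ _ _ => le_antisymm) (Finset.pairwise_sort _ _) hs ?_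
  refine (List.perm_ext_iff_of_nodup (Finset.sort_nodup _ _) ?_).2 ?_
  · refine List.nodup_append.2 ⟨Finset.sort_nodup _ _, Finset.sort_nodup _ _, ?_⟩
    intro x hx y hy
    exact (hlt x ((Finset.mem_sort _).1 hx) y ((Finset.mem_sort _).1 hy)).ne
  · intro x
    have := @hRA x
    simp only [Finset.mem_sort, List.mem_append, Finset.mem_sdiff]
    tauto

theorem elt_of_lt_card {A R : Finset Ordinal} (hRA : R ⊆ A)
    (hlt : ∀ x ∈ R, ∀ y ∈ A \ R, x < y) {a : ℕ} (ha : a < R.card) : elt A a = elt R a := by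
  unfold elt
  rw [sort_eq_append hRA hlt]
  exact List.getD_append _ _ _ _ (by simpa using ha)

theorem elt_mem_sdiff {A R : Finset Ordinal} (hRA : R ⊆ A)
    (hlt : ∀ x ∈ R, ∀ y ∈ A \ R, x < y) {a : ℕ} (ha : R.card ≤ a) (haA : a < A.card) :
    elt A a ∈ A \ R := by
  have h : elt A a = elt (A \ R) (a - R.card) := by
    unfold elt
    rw [sort_eq_append hRA hlt, List.getD_append_right _ _ _ _ (by simpa using ha)]
    simp
  rw [h]
  refine elt_mem ?_
  rw [Finset.card_sdiff_of_subset hRA]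
  omega

/-- If `⟨A, B⟩` is captured, elements of `A` and `B` in the same position are either equal or
form a captured pair. -/
theorem CapturedFam.elt_eq_or_capturedPair {T : SchemeType} {ℱ : Set (Finset Ordinal)}
    {A B : Finset Ordinal} {l : ℕ} (h : CapturedFam T ℱ 2 (pairFam A B) l)
    {a : ℕ} (ha : a < A.card) :
    elt A a = elt B a ∨ CapturedPair T ℱ (elt A a) (elt B a) l := by
  obtain ⟨⟨R, hcard, hint, hroot, hord, -, hXi, hΔ⟩, hρ⟩ := h
  have h0 : (0 : ℕ) < 2 := by norm_num
  have h1 : (1 : ℕ) < 2 := by norm_num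
  have hcard := hcard 0 h0 1 h1
  have hint := hint 0 h0 1 h1 (by norm_num)
  have hRA := hroot 0 h0
  have hRB := hroot 1 h1
  have hord := hord 0 1 one_pos h1
  have hXA := hXi 0 h0 a
  have hXB := hXi 1 h1 a
  have hΔ := hΔ 0 h0 1 h1 (by norm_num) a
  have hρ := hρ 0 h0 1 h1 (by norm_num) a
  rw [hint] at hρ
  simp only [pairFam, if_true, one_ne_zero, if_false, Nat.cast_zero, Nat.cast_one] at *
  have hA : R ⊆ A := hint ▸ Finset.inter_subset_left
  have hB : R ⊆ B := hint ▸ Finset.inter_subset_right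
  rcases lt_or_ge a R.card with haR | haR
  · left
    rw [elt_of_lt_card hA hRA haR, elt_of_lt_card hB hRB haR]
  · right
    exact ⟨hord _ (elt_mem_sdiff hA hRA haR ha) _ (elt_mem_sdiff hB hRB haR (hcard ▸ ha)),
      hXA haR ha, hXB haR (hcard ▸ ha), hΔ haR ha, hρ haR ha⟩

theorem exists_uncountable_fiber {α β : Type*} [Countable β] {s : Set α} (hs : ¬ s.Countable)
    (f : α → β) : ∃ y, ¬ {x ∈ s | f x = y}.Countable := by
  by_contra! h
  refine hs ((Set.countable_iUnion h).mono fun x hx => ?_)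
  exact Set.mem_iUnion.2 ⟨f x, hx, rfl⟩

theorem NonConstType.symm {m : ℕ} {u v : Fin m → ℝ} (h : NonConstType u v) :
    NonConstType v u := ⟨h.2, h.1⟩

/-- `(i, j, s, t)` witnesses that the type of `(u, v)` is not constant. -/
def Separates {m : ℕ} (u v : Fin m → ℝ) (d : Fin m × Fin m × ℚ × ℚ) : Prop :=
  v d.1 < d.2.2.1 ∧ (d.2.2.1 : ℝ) < u d.1 ∧ u d.2.1 < d.2.2.2 ∧ (d.2.2.2 : ℝ) < v d.2.1

theorem NonConstType.exists_separates {m : ℕ} {u v : Fin m → ℝ} (h : NonConstType u v)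
    (hne : ∀ i, u i ≠ v i) : ∃ d, Separates u v d := by
  obtain ⟨h1, h2⟩ := h
  push Not at h1 h2
  obtain ⟨i, hi⟩ := h1
  obtain ⟨j, hj⟩ := h2
  obtain ⟨s, hs, hs'⟩ := exists_rat_btwn (lt_of_le_of_ne hi (hne i).symm)
  obtain ⟨t, ht, ht'⟩ := exists_rat_btwn (lt_of_le_of_ne hj (hne j))
  exact ⟨(i, j, s, t), hs, hs', ht, ht'⟩

theorem Separates.nonConstType {m : ℕ} {u v u' v' : Fin m → ℝ} {d : Fin m × Fin m × ℚ × ℚ}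
    (h : Separates u v d) (h' : Separates u' v' d) : NonConstType u v' :=
  ⟨fun hc => (h'.1.trans h.2.1).not_gt (hc _), fun hc => (h.2.2.1.trans h'.2.2.2).not_gt (hc _)⟩

theorem exists_compatible_capPairSome {ι : Type u} {T : SchemeType} {ℱ : Set (Finset Ordinal)}
    (hcap : TwoCapturing T ℱ) {m : ℕ} {𝒜 : Set ι}
    {ζ : ι → Ordinal} (hζlt : ∀ A ∈ 𝒜, ζ A < omegaOne)
    (hζinj : ∀ A ∈ 𝒜, ∀ B ∈ 𝒜, ζ A = ζ B → A = B)
    {E : ι → Fin m → ℝ}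
    (hEdisj : ∀ A ∈ 𝒜, ∀ B ∈ 𝒜, A ≠ B → ∀ i j, E A i ≠ E B j)
    (hmain : ∀ A ∈ 𝒜, ∀ B ∈ 𝒜, A ≠ B → CapPairSome T ℱ (ζ A) (ζ B) →
      NonConstType (E A) (E B))
    {ℬ : Set (Finset ι)} (hℬ : ∀ p ∈ ℬ, QcondC 𝒜 E p) (hunc : ¬ ℬ.Countable)
    {ν : Finset ι → Ordinal} (hνlt : ∀ p ∈ ℬ, ν p < omegaOne)
    (hνinj : ∀ p ∈ ℬ, ∀ q ∈ ℬ, p ≠ q → ν p ≠ ν q) :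
    ∃ p ∈ ℬ, ∃ q ∈ ℬ, p ≠ q ∧
      (∃ r : Finset ι, QcondC 𝒜 E r ∧ p ⊆ r ∧ q ⊆ r) ∧
      CapPairSome T ℱ (ν p) (ν q) := by
  have hsep : ∀ A B, ∃ d : Option (Fin m × Fin m × ℚ × ℚ), A ∈ 𝒜 → B ∈ 𝒜 → A ≠ B →
      NonConstType (E A) (E B) → ∃ d' ∈ d, Separates (E A) (E B) d' := by
    intro A B
    by_cases h : ∃ d, Separates (E A) (E B) d
    · obtain ⟨d, hd⟩ := h
      exact ⟨some d, fun _ _ _ _ => ⟨d, rfl, hd⟩⟩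
    · exact ⟨none, fun hA hB hne hn =>
        (h (hn.exists_separates fun i => hEdisj A hA B hB hne i i)).elim⟩
  choose sep hsep using hsep
  let S : Finset ι → Finset Ordinal := fun p => insert (ν p) (p.image ζ)
  let f : Finset ι → ℕ × Finset ℕ × Finset (ℕ × ℕ × Option (Fin m × Fin m × ℚ × ℚ)) := fun p =>
    (pos (S p) (ν p), p.image fun A => pos (S p) (ζ A),
      p.offDiag.image fun x => (pos (S p) (ζ x.1), pos (S p) (ζ x.2), sep x.1 x.2))
  have hνS : ∀ p, ν p ∈ S p := fun p => Finset.mem_insert_self _ _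
  have hζS : ∀ p, ∀ A ∈ p, ζ A ∈ S p := fun p A hA =>
    Finset.mem_insert_of_mem (Finset.mem_image_of_mem _ hA)
  obtain ⟨⟨c, P, G⟩, hy⟩ := exists_uncountable_fiber hunc f
  set ℬ' := {p ∈ ℬ | f p = (c, P, G)}
  have hc : ∀ p ∈ ℬ', pos (S p) (ν p) = c := fun p hp => congrArg Prod.fst hp.2
  have hP : ∀ p ∈ ℬ', p.image (fun A => pos (S p) (ζ A)) = P := fun p hp =>
    congrArg (fun x => x.2.1) hp.2
  have hG : ∀ p ∈ ℬ', p.offDiag.image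
      (fun x => (pos (S p) (ζ x.1), pos (S p) (ζ x.2), sep x.1 x.2)) = G := fun p hp =>
    congrArg (fun x => x.2.2) hp.2
  have hSinj : Set.InjOn S ℬ' := by
    intro p hp q hq hpq
    by_contra hne
    refine hνinj p hp.1 q hq.1 hne ?_
    rw [← elt_pos (hνS p), ← elt_pos (hνS q), hc p hp, hc q hq, hpq]
  have hinf := hcap (S '' ℬ') (by
      rintro _ ⟨p, hp, rfl⟩
      refine ⟨⟨_, hνS p⟩, fun x hx => ?_⟩
      rcases Finset.mem_insert.1 (Finset.mem_coe.1 hx) with rfl | hx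
      · exact hνlt p hp.1
      · obtain ⟨A, hA, rfl⟩ := Finset.mem_image.1 hx
        exact hζlt A ((hℬ p hp.1).1 hA))
    (fun h => hy (Set.countable_of_injective_of_countable_image hSinj h))
  obtain ⟨l, _, ⟨p, hp, rfl⟩, _, ⟨q, hq, rfl⟩, hne, hl⟩ := hinf.nonempty
  have hpq : p ≠ q := fun h => hne (congrArg S h)
  have hp𝒜 : ∀ A ∈ p, A ∈ 𝒜 := fun A hA => (hℬ p hp.1).1 hA
  have hq𝒜 : ∀ A ∈ q, A ∈ 𝒜 := fun A hA => (hℬ q hq.1).1 hA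
  have hcross : ∀ A ∈ p, ∀ B ∈ q, A ≠ B → NonConstType (E A) (E B) := by
    intro A hA B hB hAB
    by_cases hpos : pos (S p) (ζ A) = pos (S q) (ζ B)
    · have h := hl.elt_eq_or_capturedPair (pos_lt_card (hζS p A hA))
      rw [elt_pos (hζS p A hA), hpos, elt_pos (hζS q B hB)] at h
      rcases h with h | h
      · exact (hAB (hζinj A (hp𝒜 A hA) B (hq𝒜 B hB) h)).elim
      · exact hmain A (hp𝒜 A hA) B (hq𝒜 B hB) hAB ⟨l, Or.inl h⟩
    · have hB' : pos (S q) (ζ B) ∈ p.image fun A => pos (S p) (ζ A) := by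
        rw [hP p hp, ← hP q hq]
        exact Finset.mem_image_of_mem (fun A => pos (S q) (ζ A)) hB
      obtain ⟨B', hB'p, hB'⟩ := Finset.mem_image.1 hB'
      have hAB' : A ≠ B' := by
        rintro rfl
        exact hpos hB'
      have hmem : (pos (S p) (ζ A), pos (S p) (ζ B'), sep A B') ∈ G := by
        rw [← hG p hp]
        exact Finset.mem_image.2 ⟨(A, B'), Finset.mem_offDiag.2 ⟨hA, hB'p, hAB'⟩, rfl⟩
      rw [← hG q hq] at hmem
      obtain ⟨⟨A₁, B₁⟩, hx, heq⟩ := Finset.mem_image.1 hmem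
      obtain ⟨hA₁, hB₁, hne₁⟩ := Finset.mem_offDiag.1 hx
      simp only [Prod.mk.injEq] at heq hA₁ hB₁ hne₁
      obtain ⟨-, hposB, hs⟩ := heq
      obtain rfl : B₁ = B := by
        refine hζinj _ (hq𝒜 _ hB₁) _ (hq𝒜 _ hB) ?_
        rw [← elt_pos (hζS q B₁ hB₁), ← elt_pos (hζS q B hB), hposB, hB']
      obtain ⟨d, hd, hsd⟩ := hsep A B' (hp𝒜 _ hA) (hp𝒜 _ hB'p) hAB'
        ((hℬ p hp.1).2 A hA B' hB'p hAB')
      obtain ⟨d₁, hd₁, hsd₁⟩ := hsep A₁ B₁ (hq𝒜 _ hA₁) (hq𝒜 _ hB₁) hne₁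
        ((hℬ q hq.1).2 A₁ hA₁ B₁ hB₁ hne₁)
      rw [hs] at hd₁
      obtain rfl := Option.mem_unique hd hd₁
      exact hsd.nonConstType hsd₁
  refine ⟨p, hp.1, q, hq.1, hpq, ⟨p ∪ q, ⟨?_, ?_⟩, Finset.subset_union_left,
    Finset.subset_union_right⟩, l, Or.inl ?_⟩
  · intro A hA
    exact (Finset.mem_union.1 (Finset.mem_coe.1 hA)).elim (hp𝒜 A) (hq𝒜 A)
  · intro A hA B hB hAB
    rcases Finset.mem_union.1 hA with hA | hA <;> rcases Finset.mem_union.1 hB with hB | hB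
    · exact (hℬ p hp.1).2 A hA B hB hAB
    · exact hcross A hA B hB hAB
    · exact (hcross B hB A hA hAB.symm).symm
    · exact (hℬ q hq.1).2 A hA B hB hAB
  · have h := hl.elt_eq_or_capturedPair (pos_lt_card (hνS p))
    rw [elt_pos (hνS p), hc p hp, ← hc q hq, elt_pos (hνS q)] at h
    exact h.resolve_left (hνinj p hp.1 q hq.1 hpq)

/-- Every uncountable set has an uncountable subset that injects into `ω₁`. -/
theorem exists_uncountable_subset_injOn {α : Type u} {s : Set α} (hs : ¬ s.Countable) :
    ∃ t ⊆ s, ¬ t.Countable ∧ ∃ ν : α → Ordinal, (∀ x ∈ t, ν x < omegaOne) ∧ Set.InjOn ν t := by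
  have hO : Cardinal.mk (Set.Iio omegaOne) = Cardinal.aleph 1 := by
    simp [omegaOne, Cardinal.mk_Iio_ordinal]
  have hlt : Cardinal.aleph0 < Cardinal.mk s := by
    rwa [← not_le, Cardinal.le_aleph0_iff_set_countable]
  obtain ⟨g⟩ : Nonempty (Set.Iio omegaOne ↪ s) := by
    rw [← Cardinal.lift_mk_le', hO]
    simpa using hlt
  obtain ⟨g, hgs, hg⟩ : ∃ g : Set.Iio omegaOne → α, (∀ x, g x ∈ s) ∧ Function.Injective g :=
    ⟨fun x => g x, fun x => (g x).2, Subtype.val_injective.comp g.injective⟩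
  have : Uncountable (Set.Iio omegaOne) := by
    rw [← Cardinal.aleph0_lt_mk_iff, ← Cardinal.aleph_one_le_iff, hO]
  refine ⟨Set.range g, Set.range_subset_iff.2 hgs, ?_, fun y => (Function.invFun g y).1,
    fun y _ => (Function.invFun g y).2, ?_⟩
  · intro h
    rw [← Set.image_univ] at h
    exact not_countable (α := Set.Iio omegaOne) (Set.countable_univ_iff.1
      (Set.countable_of_injective_of_countable_image hg.injOn h))
  · rintro _ ⟨x, rfl⟩ _ ⟨y, rfl⟩ h
    have h := Subtype.val_injective h
    rw [Function.leftInverse_invFun hg x, Function.leftInverse_invFun hg y] at h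
    rw [h]

/-- For a 2-capturing scheme `ℱ` and data `𝒜`, `ζ`, `A ↦ E_A` as in the paper: for every
uncountable `ℬ ⊆ ℚ` and every injective `ν : ℬ → ω₁` there are distinct compatible
`p, q ∈ ℬ` with `{ν(p), ν(q)}` captured at some level; in particular `ℚ` has no uncountable
antichain. -/
theorem stmt13 {ι : Type u} (T : SchemeType) (ℱ : Set (Finset Ordinal))
    (hS : IsConstructionScheme T ℱ) (hcap : TwoCapturing T ℱ)
    (nn : ℕ) (hn : 1 ≤ nn)
    (𝒜 : Set ι) (h𝒜 : ¬ 𝒜.Countable)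
    (ζ : ι → Ordinal) (hζlt : ∀ A ∈ 𝒜, ζ A < omegaOne)
    (hζinj : ∀ A ∈ 𝒜, ∀ B ∈ 𝒜, ζ A = ζ B → A = B)
    (E : ι → Fin (2 * nn) → ℝ)
    (hEmono : ∀ A ∈ 𝒜, StrictMono (E A))
    (hEdisj : ∀ A ∈ 𝒜, ∀ B ∈ 𝒜, A ≠ B → ∀ i j, E A i ≠ E B j)
    (hmain : ∀ A ∈ 𝒜, ∀ B ∈ 𝒜, A ≠ B → CapPairSome T ℱ (ζ A) (ζ B) →
      NonConstType (E A) (E B)) :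
    (∀ ℬ : Set (Finset ι), (∀ p ∈ ℬ, QcondC 𝒜 E p) → ¬ ℬ.Countable →
      ∀ ν : Finset ι → Ordinal, (∀ p ∈ ℬ, ν p < omegaOne) →
        (∀ p ∈ ℬ, ∀ q ∈ ℬ, p ≠ q → ν p ≠ ν q) →
        ∃ p ∈ ℬ, ∃ q ∈ ℬ, p ≠ q ∧
          (∃ r : Finset ι, QcondC 𝒜 E r ∧ p ⊆ r ∧ q ⊆ r) ∧
          CapPairSome T ℱ (ν p) (ν q)) ∧
    (∀ 𝒞 : Set (Finset ι), (∀ p ∈ 𝒞, QcondC 𝒜 E p) →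
      (𝒞.Pairwise fun p q => ¬ ∃ r : Finset ι, QcondC 𝒜 E r ∧ p ⊆ r ∧ q ⊆ r) →
      𝒞.Countable) := by
  have hfirst := fun ℬ hℬ hunc ν hνlt hνinj =>
    exists_compatible_capPairSome hcap hζlt hζinj hEdisj hmain (ℬ := ℬ) hℬ hunc (ν := ν) hνlt hνinj
  refine ⟨hfirst, fun 𝒞 h𝒞 hanti => ?_⟩
  by_contra hunc
  obtain ⟨ℬ, hsub, hℬ, ν, hνlt, hνinj⟩ := exists_uncountable_subset_injOn hunc
  obtain ⟨p, hp, q, hq, hpq, hcompat, -⟩ := hfirst ℬ (fun p hp => h𝒞 p (hsub hp)) hℬ ν hνlt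
    fun p hp q hq hpq h => hpq (hνinj hp hq h)
  exact hanti (hsub hp) (hsub hq) hpq hcompat

end
end
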